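/- arXiv:2603.10896 — 2 statements merged into one kernel-verified Lean document; each statement's English description precedes it below -/
import Mathlib

section
/- Let 𝒳 be a finite set, ν a finite measure on 𝒳, π a probability measure on 𝒳, and let ε > 0 and a ∈ [0,1). If Σ_{x∈𝒳} max(π({x}) − ε·ν({x}), 0) ≤ a, then d_TV(PPP(ν) ⊕ π, PPP(ν)) ≤ (1/2)·√(ε/(1−a)) + a. -/
open MeasureTheory ProbabilityTheory

/-- Total variation distance between two measures on a countable (discrete) space:
`d_TV(μ,ν) = (1/2)·Σ_x |μ({x}) − ν({x})|`. -/
noncomputable def dTV {α : Type*} [MeasurableSpace α] (μ ν : Measure α) : ℝ :=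
  (1 / 2) * ∑' x : α, |(μ {x}).toReal - (ν {x}).toReal|

/-- `PPP(ν)`: the law on `ℕ^𝒳` of a Poisson point process on the finite set `𝒳` with
intensity measure `ν`; the coordinates are independent and the coordinate at `x` is
Poisson with mean `ν({x})`. -/
noncomputable def PPP {𝒳 : Type*} [Fintype 𝒳] [MeasurableSpace 𝒳] (ν : Measure 𝒳) :
    Measure (𝒳 → ℕ) :=
  Measure.pi (fun x : 𝒳 => poissonMeasure ((ν {x}).toNNReal))

open Classical in
/-- `PPP(ν) ⊕ π`: the law of `N + δ_Y` where `N ∼ PPP(ν)` and `Y ∼ π` are independent. -/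
noncomputable def PPPplus {𝒳 : Type*} [Fintype 𝒳] [MeasurableSpace 𝒳]
    (ν : Measure 𝒳) (π : Measure 𝒳) : Measure (𝒳 → ℕ) :=
  ((PPP ν).prod π).map (fun q => fun x => q.1 x + if x = q.2 then 1 else 0)

open scoped NNReal Nat

section PoissonMoments

lemma poissonMeasure_real_succ_mul (r : ℝ≥0) (n : ℕ) :
    (poissonMeasure r).real {n + 1} * ((n + 1 : ℕ) : ℝ) = r * (poissonMeasure r).real {n} := by
  simp only [poissonMeasure_real_singleton, Nat.factorial_succ, Nat.cast_mul]
  field_simp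
  ring

lemma hasSum_poissonMeasure_mul_pred (r : ℝ≥0) {g : ℕ → ℝ} {s : ℝ}
    (hg : HasSum (fun n ↦ (poissonMeasure r).real {n} * g n) s) :
    HasSum (fun n : ℕ ↦ (poissonMeasure r).real {n} * (n * g (n - 1))) (r * s) := by
  rw [← hasSum_nat_add_iff' 1]
  have h := hg.mul_left (r : ℝ)
  simp only [← mul_assoc, ← poissonMeasure_real_succ_mul] at h ⊢
  simpa using h

lemma hasSum_poissonMeasure (r : ℝ≥0) : HasSum (fun n ↦ (poissonMeasure r).real {n}) 1 := by
  simpa only [poissonMeasure_real_singleton] using hasSum_one_poissonMeasure r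

lemma hasSum_poissonMeasure_mul_natCast (r : ℝ≥0) :
    HasSum (fun n : ℕ ↦ (poissonMeasure r).real {n} * (n : ℝ)) r := by
  simpa only [mul_one] using hasSum_poissonMeasure_mul_pred r (g := fun _ ↦ 1) (s := 1)
    (by simpa only [mul_one] using hasSum_poissonMeasure r)

lemma hasSum_poissonMeasure_mul_natCast_sq (r : ℝ≥0) :
    HasSum (fun n : ℕ ↦ (poissonMeasure r).real {n} * (n : ℝ) ^ 2) (r * (r + 1)) := by
  have h := hasSum_poissonMeasure_mul_pred r (g := fun n ↦ n + 1) (s := r + 1)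
    (by simpa [mul_add] using (hasSum_poissonMeasure_mul_natCast r).add (hasSum_poissonMeasure r))
  refine h.congr_fun ?_
  rintro (_ | n)
  · simp
  · push_cast [Nat.add_sub_cancel]
    ring

lemma memLp_natCast_poissonMeasure (r : ℝ≥0) :
    MemLp (fun n : ℕ ↦ (n : ℝ)) 2 (poissonMeasure r) := by
  rw [memLp_two_iff_integrable_sq .of_discrete, integrable_poissonMeasure_iff]
  simpa [poissonMeasure_real_singleton] using (hasSum_poissonMeasure_mul_natCast_sq r).summable

lemma integral_natCast_poissonMeasure (r : ℝ≥0) :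
    ∫ n : ℕ, (n : ℝ) ∂poissonMeasure r = r := by
  rw [integral_poissonMeasure]
  simpa [poissonMeasure_real_singleton] using (hasSum_poissonMeasure_mul_natCast r).tsum_eq

lemma variance_natCast_poissonMeasure (r : ℝ≥0) :
    Var[fun n : ℕ ↦ (n : ℝ); poissonMeasure r] = r := by
  have h : ∫ n : ℕ, (n : ℝ) ^ 2 ∂poissonMeasure r = r * (r + 1) := by
    rw [integral_poissonMeasure]
    simpa [poissonMeasure_real_singleton] using (hasSum_poissonMeasure_mul_natCast_sq r).tsum_eq
  rw [variance_eq_sub (memLp_natCast_poissonMeasure r), integral_natCast_poissonMeasure]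
  simp only [Pi.pow_apply, h]
  ring

end PoissonMoments

lemma integral_abs_le_sqrt_integral_sq {Ω : Type*} {mΩ : MeasurableSpace Ω} {μ : Measure Ω}
    [IsProbabilityMeasure μ] {X : Ω → ℝ} (hX : MemLp X 2 μ) :
    ∫ ω, |X ω| ∂μ ≤ √(∫ ω, X ω ^ 2 ∂μ) := by
  apply Real.le_sqrt_of_sq_le
  have h := variance_nonneg |X| μ
  rw [variance_eq_sub hX.abs] at h
  simpa using h

lemma hasSum_integral_of_countable {Ω : Type*} [Countable Ω] [MeasurableSpace Ω]
    [MeasurableSingletonClass Ω] {μ : Measure Ω} {f : Ω → ℝ} (hf : Integrable f μ) :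
    HasSum (fun ω ↦ μ.real {ω} * f ω) (∫ ω, f ω ∂μ) := by
  rw [← Measure.sum_smul_dirac μ] at hf
  have h := hasSum_integral_measure hf
  simpa [Measure.sum_smul_dirac, measureReal_def] using h

lemma hasSum_real_singleton {Ω : Type*} [Countable Ω] [MeasurableSpace Ω]
    [MeasurableSingletonClass Ω] (μ : Measure Ω) [IsProbabilityMeasure μ] :
    HasSum (fun ω ↦ μ.real {ω}) 1 := by
  simpa using hasSum_integral_of_countable (integrable_const (μ := μ) (1 : ℝ))

section PPP

variable {𝒳 : Type*} [Fintype 𝒳] [MeasurableSpace 𝒳]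

instance (ν : Measure 𝒳) : IsProbabilityMeasure (PPP ν) := by
  unfold PPP
  infer_instance

lemma PPP_real_singleton (ν : Measure 𝒳) (n : 𝒳 → ℕ) :
    (PPP ν).real {n} = ∏ x, (poissonMeasure (ν {x}).toNNReal).real {n x} := by
  simp [PPP, measureReal_def, ENNReal.toReal_prod]

/-- A centred linear statistic of a Poisson point process. -/
noncomputable def centredSum (ν : Measure 𝒳) (w : 𝒳 → ℝ) (n : 𝒳 → ℕ) : ℝ :=
  ∑ x, w x * (n x - (ν {x}).toReal)

lemma memLp_mul_sub_poissonMeasure (r : ℝ≥0) (w : ℝ) :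
    MemLp (fun k : ℕ ↦ w * ((k : ℝ) - r)) 2 (poissonMeasure r) :=
  ((memLp_natCast_poissonMeasure r).sub (memLp_const (r : ℝ))).const_mul w

lemma memLp_centredSum_summand (ν : Measure 𝒳) (w : 𝒳 → ℝ) (x : 𝒳) :
    MemLp (fun n : 𝒳 → ℕ ↦ w x * (n x - (ν {x}).toReal)) 2 (PPP ν) :=
  (memLp_mul_sub_poissonMeasure (ν {x}).toNNReal (w x)).comp_measurePreserving
    (measurePreserving_eval _ x)

lemma memLp_centredSum (ν : Measure 𝒳) (w : 𝒳 → ℝ) : MemLp (centredSum ν w) 2 (PPP ν) :=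
  memLp_finsetSum _ fun x _ ↦ memLp_centredSum_summand ν w x

lemma integral_centredSum (ν : Measure 𝒳) (w : 𝒳 → ℝ) :
    ∫ n, centredSum ν w n ∂PPP ν = 0 := by
  unfold centredSum
  rw [integral_finsetSum _ fun x _ ↦ (memLp_centredSum_summand ν w x).integrable one_le_two]
  refine Finset.sum_eq_zero fun x _ ↦ ?_
  have h : ∫ k : ℕ, w x * ((k : ℝ) - ((ν {x}).toNNReal : ℝ))
      ∂poissonMeasure (ν {x}).toNNReal = 0 := by
    rw [integral_const_mul, integral_sub
      ((memLp_natCast_poissonMeasure _).integrable one_le_two) (integrable_const _),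
      integral_natCast_poissonMeasure]
    simp
  rw [← h, ← (measurePreserving_eval (fun x : 𝒳 ↦ poissonMeasure (ν {x}).toNNReal) x).map_eq,
    integral_map (measurable_pi_apply x).aemeasurable .of_discrete]
  rfl

lemma integral_centredSum_sq (ν : Measure 𝒳) (w : 𝒳 → ℝ) :
    ∫ n, centredSum ν w n ^ 2 ∂PPP ν = ∑ x, w x ^ 2 * (ν {x}).toReal := by
  rw [← variance_of_integral_eq_zero (memLp_centredSum ν w).aemeasurable
    (integral_centredSum ν w)]
  have h := variance_sum_pi fun x ↦ memLp_mul_sub_poissonMeasure (ν {x}).toNNReal (w x)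
  convert h using 2 with x
  · ext n
    simp [centredSum, ENNReal.toReal]
  · rfl
  · rw [variance_const_mul, variance_sub_const .of_discrete, variance_natCast_poissonMeasure]
    rfl

open Classical in
/-- The configuration obtained by adding one point at `x`. -/
noncomputable def addPoint (x : 𝒳) (m : 𝒳 → ℕ) : 𝒳 → ℕ :=
  fun y ↦ m y + if y = x then 1 else 0

lemma mul_map_addPoint_real_singleton (ν : Measure 𝒳) (x : 𝒳) (n : 𝒳 → ℕ) :
    (ν {x}).toReal * ((PPP ν).map (addPoint x)).real {n} = n x * (PPP ν).real {n} := by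
  classical
  rw [map_measureReal_apply .of_discrete (measurableSet_singleton n)]
  rcases Nat.eq_zero_or_eq_succ_pred (n x) with h0 | h1
  · have : addPoint x ⁻¹' {n} = ∅ := by
      refine Set.eq_empty_of_forall_notMem fun m hm ↦ ?_
      have := congrFun (Set.mem_singleton_iff.1 hm) x
      simp [addPoint, h0] at this
    simp [this, h0]
  · have : addPoint x ⁻¹' {n} = {Function.update n x (n x - 1)} := by
      ext m
      simp only [Set.mem_preimage, Set.mem_singleton_iff, funext_iff, addPoint,
        Function.update_apply]
      refine forall_congr' fun y ↦ ?_
      by_cases hy : y = x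
      · subst hy
        simp only [if_true]
        lia
      · simp [hy]
    rw [this, PPP_real_singleton, PPP_real_singleton,
      ← Finset.mul_prod_erase _ _ (Finset.mem_univ x),
      ← Finset.mul_prod_erase _ _ (Finset.mem_univ x), Function.update_self, ← mul_assoc,
      ← mul_assoc]
    congr 1
    · have h := poissonMeasure_real_succ_mul (ν {x}).toNNReal (n x - 1)
      rw [show n x - 1 + 1 = n x by lia] at h
      rw [mul_comm (n x : ℝ), h]
      rfl
    · refine Finset.prod_congr rfl fun y hy ↦ ?_
      rw [Function.update_of_ne (Finset.ne_of_mem_erase hy)]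

lemma PPPplus_real_singleton [DiscreteMeasurableSpace 𝒳] (ν π : Measure 𝒳)
    [IsProbabilityMeasure π] (n : 𝒳 → ℕ) :
    (PPPplus ν π).real {n} = ∑ x, (π {x}).toReal * ((PPP ν).map (addPoint x)).real {n} := by
  unfold PPPplus
  rw [measureReal_def, Measure.map_apply .of_discrete (measurableSet_singleton n),
    Measure.prod_apply_symm .of_discrete, lintegral_fintype, ENNReal.toReal_sum]
  · refine Finset.sum_congr rfl fun x _ ↦ ?_
    rw [ENNReal.toReal_mul, mul_comm, map_measureReal_apply .of_discrete
      (measurableSet_singleton n)]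
    rfl
  · exact fun x _ ↦ ENNReal.mul_ne_top (measure_ne_top _ _) (measure_ne_top _ _)

end PPP

/-- If `Σ_{x∈𝒳} max(π({x}) − ε·ν({x}), 0) ≤ a` with `ε > 0` and `a ∈ [0,1)`, then
`d_TV(PPP(ν) ⊕ π, PPP(ν)) ≤ (1/2)·√(ε/(1−a)) + a`. -/
theorem dTV_PPPplus_le
    {𝒳 : Type*} [Fintype 𝒳] [MeasurableSpace 𝒳] [DiscreteMeasurableSpace 𝒳]
    (ν : Measure 𝒳) [IsFiniteMeasure ν]
    (π : Measure 𝒳) [IsProbabilityMeasure π]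
    (ε a : ℝ) (hε : 0 < ε) (ha0 : 0 ≤ a) (ha1 : a < 1)
    (h : ∑ x : 𝒳, max ((π {x}).toReal - ε * (ν {x}).toReal) 0 ≤ a) :
    dTV (PPPplus ν π) (PPP ν) ≤ (1 / 2) * Real.sqrt (ε / (1 - a)) + a := by
  set σ : 𝒳 → ℝ := fun x ↦ max ((π {x}).toReal - ε * (ν {x}).toReal) 0
  set w : 𝒳 → ℝ := fun x ↦ min ((π {x}).toReal / (ν {x}).toReal) ε
  have hσ (x) : 0 ≤ σ x := le_max_right _ _
  have hw0 (x) : 0 ≤ w x := le_min (by positivity) hε.le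
  have hw_le (x) : w x ≤ ε := min_le_right _ _
  have hdecomp (x) : (π {x}).toReal = w x * (ν {x}).toReal + σ x := by
    have hπ : 0 ≤ (π {x}).toReal := ENNReal.toReal_nonneg
    rcases (ENNReal.toReal_nonneg (a := ν {x})).eq_or_lt' with h0 | hpos
    · simp [σ, h0, hπ]
    · simp only [w, σ]
      rw [min_mul_of_nonneg _ _ hpos.le, div_mul_cancel₀ _ hpos.ne']
      rcases le_total (π {x}).toReal (ε * (ν {x}).toReal) with hle | hle
      · rw [min_eq_left hle, max_eq_right (by linarith), add_zero]
      · rw [min_eq_right hle, max_eq_left (by linarith)]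
        ring
  have hπ : ∑ x, (π {x}).toReal = 1 :=
    (hasSum_fintype fun x ↦ π.real {x}).unique (hasSum_real_singleton π)
  have hmass : ∑ x, w x * (ν {x}).toReal ≤ 1 := by
    rw [← hπ]
    exact Finset.sum_le_sum fun x _ ↦ by linarith [hdecomp x, hσ x]
  have hZ : ∫ n, |centredSum ν w n| ∂PPP ν ≤ √(ε / (1 - a)) := by
    refine (integral_abs_le_sqrt_integral_sq (memLp_centredSum ν w)).trans
      (Real.sqrt_le_sqrt ?_)
    rw [integral_centredSum_sq]
    calc ∑ x, w x ^ 2 * (ν {x}).toReal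
      _ ≤ ∑ x, ε * (w x * (ν {x}).toReal) := by
        refine Finset.sum_le_sum fun x _ ↦ ?_
        rw [sq, mul_assoc]
        exact mul_le_mul_of_nonneg_right (hw_le x) (mul_nonneg (hw0 x) ENNReal.toReal_nonneg)
      _ ≤ ε := by
        rw [← Finset.mul_sum]
        exact mul_le_of_le_one_right hε.le hmass
      _ ≤ ε / (1 - a) := le_div_self hε.le (by linarith) (by linarith)
  have hpt (n : 𝒳 → ℕ) : |(PPPplus ν π).real {n} - (PPP ν).real {n}| ≤
      (PPP ν).real {n} * |centredSum ν w n| +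
        ∑ x, σ x * (((PPP ν).map (addPoint x)).real {n} + (PPP ν).real {n}) := by
    have heq : (PPPplus ν π).real {n} - (PPP ν).real {n} = (PPP ν).real {n} * centredSum ν w n +
        ∑ x, σ x * (((PPP ν).map (addPoint x)).real {n} - (PPP ν).real {n}) := by
      have hP : (PPP ν).real {n} = ∑ x, (π {x}).toReal * (PPP ν).real {n} := by
        rw [← Finset.sum_mul, hπ, one_mul]
      rw [PPPplus_real_singleton, centredSum, Finset.mul_sum, ← Finset.sum_add_distrib]
      nth_rw 1 [hP]
      rw [← Finset.sum_sub_distrib]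
      refine Finset.sum_congr rfl fun x _ ↦ ?_
      rw [hdecomp x]
      linear_combination w x * mul_map_addPoint_real_singleton ν x n
    rw [heq]
    refine (abs_add_le _ _).trans (add_le_add ?_ ?_)
    · rw [abs_mul, abs_of_nonneg measureReal_nonneg]
    · refine (Finset.abs_sum_le_sum_abs _ _).trans (Finset.sum_le_sum fun x _ ↦ ?_)
      rw [abs_mul, abs_of_nonneg (hσ x)]
      refine mul_le_mul_of_nonneg_left ((abs_sub _ _).trans ?_) (hσ x)
      rw [abs_of_nonneg measureReal_nonneg, abs_of_nonneg measureReal_nonneg]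
  have hsum := (hasSum_integral_of_countable
    ((memLp_centredSum ν w).integrable one_le_two).abs).add
    (hasSum_sum (s := Finset.univ) fun x _ ↦ HasSum.mul_left (σ x) (HasSum.add
      (haveI := Measure.isProbabilityMeasure_map (μ := PPP ν) (f := addPoint x) .of_discrete
       hasSum_real_singleton ((PPP ν).map (addPoint x))) (hasSum_real_singleton (PPP ν))))
  have htsum : ∑' n, |(PPPplus ν π).real {n} - (PPP ν).real {n}| ≤
      √(ε / (1 - a)) + 2 * a := by
    refine ((hsum.summable.of_nonneg_of_le (fun _ ↦ abs_nonneg _) hpt).tsum_le_tsum hpt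
      hsum.summable).trans ?_
    rw [hsum.tsum_eq, ← Finset.sum_mul]
    linarith
  have := mul_le_mul_of_nonneg_left htsum (by norm_num : (0 : ℝ) ≤ 1 / 2)
  simp only [measureReal_def] at this
  unfold dTV
  linarith
end

section
/- For all finite vertex sets K ⊆ L ⊆ V with L nonempty: Σ_{x∈L} harm_L(x) · P_x[τ_K < ∞] = cap(K)/cap(L). -/
open MeasureTheory Filter

section Setup

variable {V : Type*} [MeasurableSpace V]

/-- Total weight at a vertex: `a_x = Σ_{z∼x} a_{x,z}`. -/
noncomputable def aTot (G : SimpleGraph V) [G.LocallyFinite] (a : V → V → ℝ) (x : V) : ℝ :=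
  ∑ z ∈ G.neighborFinset x, a x z

open Classical in
/-- Transition probabilities of the weighted random walk:
`p(x,y) = a_{x,y}/a_x` for edges and `0` otherwise. -/
noncomputable def step (G : SimpleGraph V) [G.LocallyFinite] (a : V → V → ℝ) (x y : V) : ℝ :=
  if G.Adj x y then a x y / aTot G a x else 0

/-- The event `{τ_K^+ = ∞}`: the walk never returns to `K` at a time `n ≥ 1`. -/
def noReturn (K : Set V) : Set (ℕ → V) := {w | ∀ n ≥ 1, w n ∉ K}

/-- The event `{τ_K < ∞}`: the walk hits `K`. -/
def hits (K : Set V) : Set (ℕ → V) := {w | ∃ n, w n ∈ K}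

/-- The event `{τ_K < ∞ and X_{τ_K} = y}`: the walk hits `K`, entering it at `y`. -/
def hitsAt (K : Set V) (y : V) : Set (ℕ → V) :=
  {w | (∃ n, w n ∈ K) ∧ w (sInf {n | w n ∈ K}) = y}

/-- The event `{λ_K < ∞ and X_{λ_K} = y}`: the walk visits `K`, finitely often,
and its last visit to `K` is at `y`. -/
def lastVisitAt (K : Set V) (y : V) : Set (ℕ → V) :=
  {w | (∃ n, w n ∈ K) ∧ {n | w n ∈ K}.Finite ∧ w (sSup {n | w n ∈ K}) = y}

open Classical in
/-- The equilibrium measure of a finite vertex set `K`: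
`e_K(x) = a_x · P_x[τ_K^+ = ∞]` for `x ∈ K`, and `0` otherwise. -/
noncomputable def equil (G : SimpleGraph V) [G.LocallyFinite] (a : V → V → ℝ)
    (P : V → Measure (ℕ → V)) (K : Finset V) (x : V) : ℝ :=
  if x ∈ K then aTot G a x * ((P x) (noReturn (K : Set V))).toReal else 0

/-- The capacity of a finite vertex set `K`: `cap(K) = Σ_{x∈K} e_K(x)`. -/
noncomputable def capa (G : SimpleGraph V) [G.LocallyFinite] (a : V → V → ℝ)
    (P : V → Measure (ℕ → V)) (K : Finset V) : ℝ :=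
  ∑ x ∈ K, equil G a P K x

/-- The harmonic measure of a nonempty finite vertex set `K`: `harm_K = e_K / cap(K)`. -/
noncomputable def harm (G : SimpleGraph V) [G.LocallyFinite] (a : V → V → ℝ)
    (P : V → Measure (ℕ → V)) (K : Finset V) (x : V) : ℝ :=
  equil G a P K x / capa G a P K

end Setup

open scoped ENNReal

section MarkovLaw

variable {V : Type*}

/-- The cylinder sets fixing an initial segment of the path. -/
def prefixCylinders (V : Type*) : Set (Set (ℕ → V)) :=
  {S | ∃ (n : ℕ) (c : ℕ → V), S = {w | ∀ i ≤ n, w i = c i}}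

lemma isPiSystem_prefixCylinders : IsPiSystem (prefixCylinders V) := by
  rintro _ ⟨n, c, rfl⟩ _ ⟨m, d, rfl⟩ ⟨w, hw1, hw2⟩
  refine ⟨max n m, w, ?_⟩
  ext u
  simp only [Set.mem_inter_iff, Set.mem_ofPred_eq] at hw1 hw2 ⊢
  constructor
  · rintro ⟨h1, h2⟩ i hi
    rcases le_max_iff.1 hi with h | h
    · rw [h1 i h, hw1 i h]
    · rw [h2 i h, hw2 i h]
  · intro h
    exact ⟨fun i hi => by rw [h i (le_max_of_le_left hi), hw1 i hi],
      fun i hi => by rw [h i (le_max_of_le_right hi), hw2 i hi]⟩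

/-- The path seen from time `n` on. -/
def pathShift (n : ℕ) (w : ℕ → V) : ℕ → V := fun m => w (m + n)

/-- The event that the last visit to `K` happens at time `n` and at the vertex `y`. -/
def lastVisitAtTime (K : Set V) (n : ℕ) (y : V) : Set (ℕ → V) :=
  {w | w n = y} ∩ pathShift n ⁻¹' noReturn K

lemma lastVisitAtTime_time_le {K : Set V} {n m : ℕ} {y z : V} (hz : z ∈ K) {w : ℕ → V}
    (h : w ∈ lastVisitAtTime K n y) (h' : w ∈ lastVisitAtTime K m z) : m ≤ n := by
  by_contra! hlt
  refine h.2 (m - n) (by omega) ?_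
  have hm : m - n + n = m := by omega
  have hw : w m = z := h'.1
  simpa [pathShift, hm, hw] using hz

lemma pairwise_disjoint_lastVisitAtTime (K : Set V) :
    Pairwise (Function.onFun Disjoint
      fun q : K × ℕ => lastVisitAtTime K q.2 (q.1 : V)) := by
  rintro ⟨y, n⟩ ⟨z, m⟩ hne
  refine Set.disjoint_left.2 fun w h h' => hne ?_
  have hnm : n = m :=
    le_antisymm (lastVisitAtTime_time_le y.2 h' h) (lastVisitAtTime_time_le z.2 h h')
  subst hnm
  have hy : w n = y := h.1
  have hz : w n = z := h'.1
  exact Prod.ext (Subtype.ext (hy.symm.trans hz)) rfl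

lemma mem_hits_iff_exists_lastVisitAtTime {K : Set V} {w : ℕ → V}
    (hfin : {n | w n ∈ K}.Finite) :
    w ∈ hits K ↔ ∃ q : K × ℕ, w ∈ lastVisitAtTime K q.2 (q.1 : V) := by
  constructor
  · rintro ⟨n, hn⟩
    obtain ⟨m, hm, hmax⟩ := hfin.exists_maximal ⟨n, hn⟩
    refine ⟨(⟨w m, hm⟩, m), rfl, fun k hk hmem => ?_⟩
    have := hmax (y := k + m) hmem (by omega)
    omega
  · rintro ⟨⟨y, n⟩, h, -⟩
    exact ⟨n, (show w n = y from h) ▸ y.2⟩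

variable [MeasurableSpace V]

lemma measurable_pathShift (n : ℕ) : Measurable (pathShift (V := V) n) :=
  measurable_pi_lambda _ fun m => measurable_pi_apply (m + n)

open Classical in
/-- `P` is the family of laws of the Markov chain with transition matrix `p`. -/
structure IsMarkovLaw (p : V → V → ℝ≥0∞) (P : V → Measure (ℕ → V)) : Prop where
  isProbabilityMeasure : ∀ x, IsProbabilityMeasure (P x)
  measure_cylinder : ∀ (x : V) (n : ℕ) (c : ℕ → V),
    P x {w | ∀ i ≤ n, w i = c i} =
      (if c 0 = x then 1 else 0) * ∏ i ∈ Finset.range n, p (c i) (c (i + 1))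

namespace IsMarkovLaw

variable {p : V → V → ℝ≥0∞} {P : V → Measure (ℕ → V)}

open Classical in
lemma measure_start (h : IsMarkovLaw p P) (x y : V) :
    P x {w | w 0 = y} = if y = x then 1 else 0 := by
  simpa using h.measure_cylinder x 0 (fun _ => y)

lemma measure_hits_of_mem (h : IsMarkovLaw p P) {K : Set V} {x : V} (hx : x ∈ K) :
    P x (hits K) = 1 := by
  have := h.isProbabilityMeasure x
  refine le_antisymm prob_le_one ?_
  rw [← (by simp [h.measure_start] : P x {w | w 0 = x} = 1)]
  exact measure_mono fun w hw => ⟨0, (show w 0 = x from hw) ▸ hx⟩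

end IsMarkovLaw

variable [DiscreteMeasurableSpace V]

lemma measurableSet_apply_eq (n : ℕ) (y : V) : MeasurableSet {w : ℕ → V | w n = y} :=
  (MeasurableSet.of_discrete (s := ({y} : Set V))).preimage (measurable_pi_apply n)

lemma measurableSet_noReturn (K : Set V) : MeasurableSet (noReturn K) := by
  have h : noReturn K = ⋂ n, ⋂ (_ : n ≥ 1), (fun w : ℕ → V => w n) ⁻¹' Kᶜ := by
    ext; simp [noReturn]
  rw [h]
  exact MeasurableSet.iInter fun n => MeasurableSet.iInter fun _ =>
    measurable_pi_apply n MeasurableSet.of_discrete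

lemma measurableSet_lastVisitAtTime (K : Set V) (n : ℕ) (y : V) :
    MeasurableSet (lastVisitAtTime K n y) :=
  (measurableSet_apply_eq n y).inter (measurable_pathShift n (measurableSet_noReturn K))

namespace IsMarkovLaw

variable {p : V → V → ℝ≥0∞} {P : V → Measure (ℕ → V)}

lemma ae_start (h : IsMarkovLaw p P) (x : V) : ∀ᵐ w ∂ P x, w 0 = x := by
  have := h.isProbabilityMeasure x
  exact (prob_compl_eq_zero_iff (measurableSet_apply_eq 0 x)).2 (by simp [h.measure_start])

lemma measure_shift_cylinder (h : IsMarkovLaw p P) (x : V) (n : ℕ) (c : ℕ → V) :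
    P x (pathShift 1 ⁻¹' {w | ∀ i ≤ n, w i = c i}) =
      p x (c 0) * ∏ i ∈ Finset.range n, p (c i) (c (i + 1)) := by
  have hcyl := h.measure_cylinder x (n + 1) (fun i => Nat.casesOn i x c)
  rw [Finset.prod_range_succ'] at hcyl
  rw [mul_comm, ← one_mul (_ * _)]
  refine Eq.trans (measure_congr ?_) (hcyl.trans (congrArg (· * _) (if_pos rfl)))
  filter_upwards [h.ae_start x] with w hw
  refine propext ⟨fun hw' i hi => ?_, fun hw' i hi => hw' (i + 1) (by omega)⟩
  cases i with
  | zero => exact hw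
  | succ i => exact hw' i (by omega)

lemma measure_one (h : IsMarkovLaw p P) (x y : V) : P x {w | w 1 = y} = p x y := by
  have hs := h.measure_shift_cylinder x 0 (fun _ => y)
  simpa [pathShift] using hs

end IsMarkovLaw

variable [Countable V]

lemma generateFrom_prefixCylinders :
    (MeasurableSpace.pi : MeasurableSpace (ℕ → V)) =
      MeasurableSpace.generateFrom (prefixCylinders V) := by
  apply le_antisymm
  · refine iSup_le fun n => ?_
    rintro _ ⟨s, -, rfl⟩
    have h : (fun w : ℕ → V => w n) ⁻¹' s =
        ⋃ (c : Fin (n + 1) → V) (_ : c (Fin.last n) ∈ s),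
          {w : ℕ → V | ∀ i ≤ n, w i = c (Fin.ofNat (n + 1) i)} := by
      ext w
      simp only [Set.mem_preimage, Set.mem_iUnion, Set.mem_ofPred_eq, exists_prop]
      constructor
      · intro hw
        refine ⟨fun i => w i, by simpa using hw, fun i hi => ?_⟩
        simp [Fin.ofNat, Nat.mod_eq_of_lt (Nat.lt_succ_of_le hi)]
      · rintro ⟨c, hc, hw⟩
        have hlast : Fin.ofNat (n + 1) n = Fin.last n := by
          ext; simp [Fin.ofNat]
        rw [hw n le_rfl, hlast]
        exact hc
    rw [h]
    refine MeasurableSet.iUnion fun c => MeasurableSet.iUnion fun _ => ?_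
    exact MeasurableSpace.measurableSet_generateFrom ⟨n, _, rfl⟩
  · refine MeasurableSpace.generateFrom_le ?_
    rintro _ ⟨n, c, rfl⟩
    have h : {w : ℕ → V | ∀ i ≤ n, w i = c i} = ⋂ i, ⋂ (_ : i ≤ n), {w | w i = c i} := by
      ext; simp
    rw [h]
    exact MeasurableSet.iInter fun i => MeasurableSet.iInter fun _ =>
      measurableSet_apply_eq i (c i)

namespace IsMarkovLaw

variable {p : V → V → ℝ≥0∞} {P : V → Measure (ℕ → V)}

lemma tsum_measure_apply_eq (h : IsMarkovLaw p P) (x : V) (n : ℕ) :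
    ∑' y, P x {w | w n = y} = 1 := by
  have := h.isProbabilityMeasure x
  rw [← measure_iUnion _ (measurableSet_apply_eq n)]
  · convert measure_univ (μ := P x)
    ext w
    simp
  · intro y z hyz
    exact Set.disjoint_left.2 fun w hy hz => hyz (hy.symm.trans hz)

lemma tsum_transition (h : IsMarkovLaw p P) (x : V) : ∑' y, p x y = 1 := by
  simpa only [h.measure_one] using h.tsum_measure_apply_eq x 1

/-- The Markov property at time one. -/
lemma map_pathShift_one (h : IsMarkovLaw p P) (x : V) :
    (P x).map (pathShift 1) = Measure.sum fun y => p x y • P y := by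
  have := h.isProbabilityMeasure
  refine (ext_of_generate_finite (prefixCylinders V) generateFrom_prefixCylinders
    isPiSystem_prefixCylinders ?_ ?_)
  · rintro S hS
    have hmeas : MeasurableSet S := by
      rw [generateFrom_prefixCylinders]
      exact MeasurableSpace.measurableSet_generateFrom hS
    obtain ⟨n, c, rfl⟩ := hS
    rw [Measure.map_apply (measurable_pathShift 1) hmeas, h.measure_shift_cylinder,
      Measure.sum_apply _ hmeas, tsum_eq_single (c 0)]
    · simp [h.measure_cylinder]
    · intro y hy
      simp [h.measure_cylinder, hy.symm]
  · rw [Measure.map_apply (measurable_pathShift 1) MeasurableSet.univ,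
      Measure.sum_apply _ MeasurableSet.univ]
    simp [h.tsum_transition]

lemma measure_preimage_pathShift_one (h : IsMarkovLaw p P) (x : V) {A : Set (ℕ → V)}
    (hA : MeasurableSet A) : P x (pathShift 1 ⁻¹' A) = ∑' y, p x y * P y A := by
  rw [← Measure.map_apply (measurable_pathShift 1) hA, h.map_pathShift_one,
    Measure.sum_apply _ hA]
  simp

lemma measure_apply_succ (h : IsMarkovLaw p P) (x y : V) (n : ℕ) :
    P x {w | w (n + 1) = y} = ∑' z, p x z * P z {w | w n = y} :=
  h.measure_preimage_pathShift_one x (measurableSet_apply_eq n y)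

/-- The Markov property at a deterministic time. -/
lemma measure_apply_eq_inter_pathShift (h : IsMarkovLaw p P) {A : Set (ℕ → V)}
    (hA : MeasurableSet A) (n : ℕ) (x y : V) :
    P x ({w | w n = y} ∩ pathShift n ⁻¹' A) = P x {w | w n = y} * P y A := by
  induction n generalizing x with
  | zero =>
    rw [h.measure_start]
    split_ifs with hyx
    · subst hyx
      rw [one_mul]
      refine measure_congr ?_
      filter_upwards [h.ae_start y] with w hw
      exact propext ⟨fun hw' => hw'.2, fun hw' => ⟨hw, hw'⟩⟩
    · rw [zero_mul]
      exact measure_mono_null Set.inter_subset_left (by simp [h.measure_start, hyx])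
  | succ n ih =>
    rw [h.measure_apply_succ, ← ENNReal.tsum_mul_right]
    refine (h.measure_preimage_pathShift_one x ((measurableSet_apply_eq n y).inter
      (measurable_pathShift n hA))).trans (tsum_congr fun z => ?_)
    rw [ih z, mul_assoc]

lemma measure_apply_succ' (h : IsMarkovLaw p P) (x y : V) (n : ℕ) :
    P x {w | w (n + 1) = y} = ∑' z, P x {w | w n = z} * p z y := by
  simp_rw [← h.measure_one, ← h.measure_apply_eq_inter_pathShift (measurableSet_apply_eq 1 y)]
  rw [← measure_iUnion _ fun z => (measurableSet_apply_eq n z).inter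
    (measurable_pathShift n (measurableSet_apply_eq 1 y))]
  · congr 1
    ext w
    simp [pathShift, add_comm]
  · intro z y hzy
    exact Set.disjoint_left.2 fun w hz hy => hzy (hz.1.symm.trans hy.1)

/-- Detailed balance propagates to the transition probabilities at every time. -/
lemma reversible (h : IsMarkovLaw p P) {m : V → ℝ≥0∞}
    (hm : ∀ x y, m x * p x y = m y * p y x) (n : ℕ) (x y : V) :
    m x * P x {w | w n = y} = m y * P y {w | w n = x} := by
  induction n generalizing x with
  | zero =>
    rw [h.measure_start, h.measure_start]
    by_cases hxy : x = y
    · subst hxy; rfl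
    · simp [hxy, Ne.symm hxy]
  | succ n ih =>
    rw [h.measure_apply_succ, h.measure_apply_succ', ← ENNReal.tsum_mul_left,
      ← ENNReal.tsum_mul_left]
    refine tsum_congr fun z => ?_
    rw [← mul_assoc, hm, mul_right_comm, ih, mul_assoc]

/-- Last exit decomposition of the probability of hitting `K`. -/
lemma measure_hits (h : IsMarkovLaw p P)
    (htrans : ∀ x y : V, ∀ᵐ w ∂ P x, {n : ℕ | w n = y}.Finite) (K : Finset V) (x : V) :
    P x (hits (K : Set V)) =
      ∑ y ∈ K, ∑' n, P x {w | w n = y} * P y (noReturn (K : Set V)) := by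
  have hfin : ∀ᵐ w ∂ P x, {n | w n ∈ (K : Set V)}.Finite := by
    have hall : ∀ᵐ w ∂ P x, ∀ y, {n : ℕ | w n = y}.Finite := ae_all_iff.2 (htrans x)
    filter_upwards [hall] with w hw
    have hK : {n | w n ∈ (K : Set V)} = ⋃ y ∈ K, {n | w n = y} := by
      ext; simp
    rw [hK]
    exact K.finite_toSet.biUnion fun y _ => hw y
  have hdec : P x (hits (K : Set V)) =
      P x (⋃ q : ↥(K : Set V) × ℕ, lastVisitAtTime (K : Set V) q.2 (q.1 : V)) := by
    refine measure_congr ?_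
    filter_upwards [hfin] with w hw
    exact propext ((mem_hits_iff_exists_lastVisitAtTime hw).trans Set.mem_iUnion.symm)
  rw [hdec, measure_iUnion (pairwise_disjoint_lastVisitAtTime _)
    fun q => measurableSet_lastVisitAtTime _ _ _]
  simp_rw [lastVisitAtTime, h.measure_apply_eq_inter_pathShift (measurableSet_noReturn _)]
  rw [ENNReal.tsum_prod (f := fun (y : (K : Set V)) (n : ℕ) =>
    P x {w | w n = (y : V)} * P y (noReturn (K : Set V)))]
  exact Finset.tsum_subtype K fun y : V =>
    ∑' n, P x {w | w n = y} * P y (noReturn (K : Set V))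

/-- Started from the equilibrium measure of `L`, a reversible transient chain hits `K ⊆ L` with
total mass the capacity of `K`. -/
lemma sum_equilibrium_mul_measure_hits (h : IsMarkovLaw p P) {m : V → ℝ≥0∞}
    (hm : ∀ x y, m x * p x y = m y * p y x)
    (htrans : ∀ x y : V, ∀ᵐ w ∂ P x, {n : ℕ | w n = y}.Finite)
    {K L : Finset V} (hKL : K ⊆ L) :
    ∑ x ∈ L, m x * P x (noReturn (L : Set V)) * P x (hits (K : Set V)) =
      ∑ y ∈ K, m y * P y (noReturn (K : Set V)) := by
  have hhit : ∀ y ∈ K, m y * P y (noReturn (K : Set V)) =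
      ∑ x ∈ L, m y * P y (noReturn (K : Set V)) *
        ∑' n, P y {w | w n = x} * P x (noReturn (L : Set V)) := fun y hy => by
    rw [← Finset.mul_sum, ← h.measure_hits htrans, h.measure_hits_of_mem (hKL hy), mul_one]
  rw [Finset.sum_congr rfl hhit, Finset.sum_comm]
  refine Finset.sum_congr rfl fun x _ => ?_
  rw [h.measure_hits htrans, Finset.mul_sum]
  refine Finset.sum_congr rfl fun y _ => ?_
  rw [← ENNReal.tsum_mul_left, ← ENNReal.tsum_mul_left]
  refine tsum_congr fun n => ?_
  calc m x * P x (noReturn (L : Set V)) * (P x {w | w n = y} * P y (noReturn (K : Set V)))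
      = (m x * P x {w | w n = y}) * (P x (noReturn (L : Set V)) *
          P y (noReturn (K : Set V))) := by ring
    _ = (m y * P y {w | w n = x}) * (P x (noReturn (L : Set V)) *
          P y (noReturn (K : Set V))) := by rw [h.reversible hm]
    _ = _ := by ring

end IsMarkovLaw

end MarkovLaw


section Conductances

variable {V : Type*} (G : SimpleGraph V) [G.LocallyFinite] {a : V → V → ℝ}

lemma aTot_nonneg (hpos : ∀ x y, G.Adj x y → 0 < a x y) (x : V) : 0 ≤ aTot G a x :=
  Finset.sum_nonneg fun z hz => (hpos x z ((G.mem_neighborFinset x z).1 hz)).le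

lemma aTot_mul_step (hpos : ∀ x y, G.Adj x y → 0 < a x y) {x y : V} (hxy : G.Adj x y) :
    aTot G a x * step G a x y = a x y := by
  have hx : 0 < aTot G a x :=
    Finset.sum_pos (fun z hz => hpos x z ((G.mem_neighborFinset x z).1 hz))
      ⟨y, (G.mem_neighborFinset x y).2 hxy⟩
  rw [step, if_pos hxy, mul_div_cancel₀ _ hx.ne']

lemma aTot_mul_step_symm (hsymm : ∀ x y, a x y = a y x)
    (hpos : ∀ x y, G.Adj x y → 0 < a x y) (x y : V) :
    aTot G a x * step G a x y = aTot G a y * step G a y x := by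
  by_cases hxy : G.Adj x y
  · rw [aTot_mul_step G hpos hxy, aTot_mul_step G hpos hxy.symm, hsymm]
  · simp [step, hxy, G.adj_comm y x]

end Conductances

open ProbabilityTheory in
open Classical in
/-- For finite vertex sets `K ⊆ L` with `L` nonempty,
`Σ_{x∈L} harm_L(x) · P_x[τ_K < ∞] = cap(K)/cap(L)`. -/
theorem harm_hitting_capacity_ratio
    {V : Type*} [Countable V] [MeasurableSpace V] [DiscreteMeasurableSpace V]
    (G : SimpleGraph V) [G.LocallyFinite] (hconn : G.Connected)
    (a : V → V → ℝ)
    (hsymm : ∀ x y, a x y = a y x)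
    (hpos : ∀ x y, G.Adj x y → 0 < a x y)
    (P : V → Measure (ℕ → V)) (hprob : ∀ x, IsProbabilityMeasure (P x))
    (hP : ∀ (x : V) (n : ℕ) (c : ℕ → V),
      P x {w | ∀ i ≤ n, w i = c i} =
        (if c 0 = x then 1 else 0) *
          ∏ i ∈ Finset.range n, ENNReal.ofReal (step G a (c i) (c (i + 1))))
    (htrans : ∀ x y : V, ∀ᵐ w ∂ P x, {n : ℕ | w n = y}.Finite)
    (K L : Finset V) (hKL : K ⊆ L) (hL : L.Nonempty) :
    ∑ x ∈ L, harm G a P L x * ((P x) (hits (K : Set V))).toReal =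
      capa G a P K / capa G a P L := by
  have hlaw : IsMarkovLaw (fun x y => ENNReal.ofReal (step G a x y)) P := ⟨hprob, hP⟩
  have hrev : ∀ x y, ENNReal.ofReal (aTot G a x) * ENNReal.ofReal (step G a x y) =
      ENNReal.ofReal (aTot G a y) * ENNReal.ofReal (step G a y x) := fun x y => by
    rw [← ENNReal.ofReal_mul (aTot_nonneg G hpos x), ← ENNReal.ofReal_mul (aTot_nonneg G hpos y),
      aTot_mul_step_symm G hsymm hpos]
  have hequil : ∀ M : Finset V, ∀ x ∈ M, equil G a P M x =
      (ENNReal.ofReal (aTot G a x) * P x (noReturn (M : Set V))).toReal := fun M x hx => by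
    rw [equil, if_pos hx, ENNReal.toReal_mul, ENNReal.toReal_ofReal (aTot_nonneg G hpos x)]
  have hsum := congrArg ENNReal.toReal
    (hlaw.sum_equilibrium_mul_measure_hits hrev htrans hKL)
  rw [ENNReal.toReal_sum fun x _ => by finiteness, ENNReal.toReal_sum fun x _ => by finiteness,
    ← Finset.sum_congr rfl (hequil K)] at hsum
  simp_rw [harm, div_mul_eq_mul_div]
  rw [← Finset.sum_div, show capa G a P K = _ from hsum.symm]
  congr 1
  exact Finset.sum_congr rfl fun x hx => by rw [hequil L x hx, ← ENNReal.toReal_mul]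
end
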